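/- arXiv:1501.03183 — 7 statements merged into one kernel-verified Lean document; each statement's English description precedes it below -/
import Mathlib

section
/- Let D be the unital C*-algebra of all continuous functions f : [0,1] → M₂(ℂ) such that f(0) and f(1) are diagonal matrices, and let π : D → ℂ⁴ be the star-algebra homomorphism π(f) = (f(0)₁₁, f(0)₂₂, f(1)₁₁, f(1)₂₂). Then there is no ℂ-linear star-algebra homomorphism σ : ℂ⁴ → D (not required to be unital) with π ∘ σ = id on ℂ⁴. -/
/-- The unital C*-subalgebra of `C([0,1], M₂(ℂ))` consisting of the continuous functions
whose values at `0` and `1` are diagonal matrices.  This is a concrete realization of the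
universal unital C*-algebra generated by two projections, i.e. of `ℂ² *_ℂ ℂ²`. -/
noncomputable def twoProjAlgebra :
    StarSubalgebra ℂ C(unitInterval, Matrix (Fin 2) (Fin 2) ℂ) where
  carrier := {f | (f 0).IsDiag ∧ (f 1).IsDiag}
  mul_mem' := by
    rintro f g ⟨hf0, hf1⟩ ⟨hg0, hg1⟩
    have key : ∀ (A B : Matrix (Fin 2) (Fin 2) ℂ), A.IsDiag → B.IsDiag → (A * B).IsDiag := by
      intro A B hA hB i j hij
      rw [Matrix.mul_apply]
      refine Finset.sum_eq_zero fun k _ => ?_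
      rcases eq_or_ne i k with rfl | hik
      · rw [hB hij, mul_zero]
      · rw [hA hik, zero_mul]
    exact ⟨key _ _ hf0 hg0, key _ _ hf1 hg1⟩
  one_mem' := by
    constructor <;> exact Matrix.isDiag_one
  add_mem' := by
    rintro f g ⟨hf0, hf1⟩ ⟨hg0, hg1⟩
    exact ⟨hf0.add hg0, hf1.add hg1⟩
  zero_mem' := by
    constructor <;> exact Matrix.isDiag_zero
  algebraMap_mem' := by
    intro c
    constructor <;>
    · intro i j hij
      simp [Matrix.algebraMap_matrix_apply, hij]
  star_mem' := by
    rintro f ⟨hf0, hf1⟩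
    exact ⟨by simpa [Matrix.star_eq_conjTranspose] using hf0.conjTranspose,
      by simpa [Matrix.star_eq_conjTranspose] using hf1.conjTranspose⟩

/-- The quotient map onto `ℂ⁴ ≅ ℂ² ⊗ ℂ²`: evaluation of the diagonal entries at the two
endpoints, `π(f) = (f(0)₁₁, f(0)₂₂, f(1)₁₁, f(1)₂₂)`. -/
noncomputable def endpointDiagMap (f : twoProjAlgebra) : Fin 4 → ℂ :=
  ![(f : C(unitInterval, Matrix (Fin 2) (Fin 2) ℂ)) 0 0 0,
    (f : C(unitInterval, Matrix (Fin 2) (Fin 2) ℂ)) 0 1 1,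
    (f : C(unitInterval, Matrix (Fin 2) (Fin 2) ℂ)) 1 0 0,
    (f : C(unitInterval, Matrix (Fin 2) (Fin 2) ℂ)) 1 1 1]

/-- The trace of an idempotent `2 × 2` matrix over a domain is `0`, `1` or `2`. -/
theorem Matrix.trace_fin_two_of_isIdempotentElem {R : Type*} [CommRing R] [IsDomain R]
    {A : Matrix (Fin 2) (Fin 2) R} (hA : IsIdempotentElem A) :
    A.trace = 0 ∨ A.trace = 1 ∨ A.trace = 2 := by
  have entry (i j : Fin 2) : A i 0 * A 0 j + A i 1 * A 1 j = A i j := by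
    simpa [Matrix.mul_apply, Fin.sum_univ_two] using congrFun (congrFun hA.eq i) j
  have h00 := entry 0 0
  have h01 := entry 0 1
  have h11 := entry 1 1
  rw [Matrix.trace_fin_two]
  by_cases ht : A 0 0 + A 1 1 = 1
  · exact .inr (.inl ht)
  have hb : A 0 1 = 0 := by
    have h : A 0 1 * (A 0 0 + A 1 1 - 1) = 0 := by linear_combination h01
    exact (mul_eq_zero.mp h).resolve_right (sub_ne_zero.mpr ht)
  have ha : IsIdempotentElem (A 0 0) := by simpa [hb, IsIdempotentElem] using h00
  have hd : IsIdempotentElem (A 1 1) := by simpa [hb, IsIdempotentElem] using h11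
  rcases IsIdempotentElem.iff_eq_zero_or_one.mp ha with h | h <;>
    rcases IsIdempotentElem.iff_eq_zero_or_one.mp hd with h' | h' <;>
    simp [h, h', one_add_one_eq_two]

/-- A continuous path of idempotent complex `2 × 2` matrices cannot join trace `0` to trace `1`. -/
theorem trace_ne_one_of_isIdempotentElem {X : Type*} [TopologicalSpace X] [PreconnectedSpace X]
    {f : C(X, Matrix (Fin 2) (Fin 2) ℂ)} (hf : IsIdempotentElem f) {x : X}
    (hx : (f x).trace = 0) (y : X) : (f y).trace ≠ 1 := by
  intro hy
  have hcont : Continuous fun z => (f z).trace.re :=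
    Complex.continuous_re.comp f.continuous.matrix_trace
  obtain ⟨z, hz⟩ : (1 / 2 : ℝ) ∈ Set.range fun z => (f z).trace.re :=
    mem_range_of_exists_le_of_exists_ge hcont ⟨x, by simp [hx]⟩ ⟨y, by norm_num [hy]⟩
  have hid : IsIdempotentElem (f z) := DFunLike.congr_fun hf.eq z
  rcases Matrix.trace_fin_two_of_isIdempotentElem hid with h | h | h <;>
    norm_num [h] at hz


/-- There is no (not necessarily unital) ℂ-linear star-algebra homomorphism
`σ : ℂ⁴ → D` splitting the quotient map `π : D → ℂ⁴`, where `D` is the universal unital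
C*-algebra generated by two projections. -/
theorem no_splitting_two_projections :
    ¬ ∃ σ : (Fin 4 → ℂ) →⋆ₙₐ[ℂ] twoProjAlgebra,
        ∀ x : Fin 4 → ℂ, endpointDiagMap (σ x) = x := by
  rintro ⟨σ, hσ⟩
  let e : Fin 4 → ℂ := Pi.single 0 1
  let p : C(unitInterval, Matrix (Fin 2) (Fin 2) ℂ) := σ e
  have he : e * e = e := by simp [e, ← Pi.single_mul]
  have hp : IsIdempotentElem p := congrArg Subtype.val ((map_mul σ e e).symm.trans (by rw [he]))
  have h00 : p 0 0 0 = 1 := by simpa [endpointDiagMap, e] using congrFun (hσ e) 0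
  have h01 : p 0 1 1 = 0 := by simpa [endpointDiagMap, e] using congrFun (hσ e) 1
  have h10 : p 1 0 0 = 0 := by simpa [endpointDiagMap, e] using congrFun (hσ e) 2
  have h11 : p 1 1 1 = 0 := by simpa [endpointDiagMap, e] using congrFun (hσ e) 3
  exact trace_ne_one_of_isIdempotentElem hp (x := 1) (by simp [Matrix.trace_fin_two, h10, h11]) 0
    (by simp [Matrix.trace_fin_two, h00, h01])
end

section
/- Let G and H be abelian groups, r ∈ G, s ∈ H, let b ≥ 1 be an integer, and let u, w be integers with gcd(u, w) = 1. Let v = (u, r, (−w, 0, …, 0), −s) ∈ ℤ × G × ℤᵇ × H. Then the quotient group (ℤ × G × ℤᵇ × H)/⟨v⟩ is isomorphic, as an abelian group, to ℤᵇ × G × H. -/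
/-- For abelian groups `G, H`, `r ∈ G`, `s ∈ H`, `b ≥ 1`, and coprime integers `u, w`, the
quotient of `ℤ × G × ℤᵇ × H` by the cyclic subgroup generated by
`v = (u, r, (−w, 0, …, 0), −s)` is isomorphic to `ℤᵇ × G × H`. -/
theorem quotient_iso_of_coprime (b : ℕ) (hb : 1 ≤ b) (G H : Type)
    [AddCommGroup G] [AddCommGroup H] (r : G) (s : H) (u w : ℤ)
    (huw : Int.gcd u w = 1) :
    Nonempty (((ℤ × G × (Fin b → ℤ) × H) ⧸ AddSubgroup.zmultiples
        ((u, r, fun i : Fin b => if (i : ℕ) = 0 then -w else 0, -s) : ℤ × G × (Fin b → ℤ) × H))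
      ≃+ (Fin b → ℤ) × G × H) := by
  obtain ⟨a, c, hac⟩ : ∃ a c : ℤ, a * u + c * w = 1 := Int.isCoprime_iff_gcd_eq_one.mpr huw
  let o : Fin b := ⟨0, hb⟩
  have ho (i : Fin b) (hi : (i : ℕ) = 0) : i = o := Fin.ext hi
  let f : (ℤ × G × (Fin b → ℤ) × H) →+ (Fin b → ℤ) × G × H := AddMonoidHom.mk'
    (fun p => (fun i => if (i : ℕ) = 0 then w * p.1 + u * p.2.2.1 o else p.2.2.1 i,
      p.2.1 - (a * p.1 - c * p.2.2.1 o) • r, p.2.2.2 + (a * p.1 - c * p.2.2.1 o) • s)) (by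
      rintro ⟨n, g, x, h⟩ ⟨n', g', x', h'⟩
      refine Prod.ext (funext fun i => ?_) (Prod.ext ?_ ?_)
      · by_cases hi : (i : ℕ) = 0
        · simp only [Prod.fst_add, Prod.snd_add, Pi.add_apply, if_pos hi]
          ring
        · simp only [Prod.fst_add, Prod.snd_add, Pi.add_apply, if_neg hi]
      · simp only [Prod.fst_add, Prod.snd_add, Pi.add_apply]
        module
      · simp only [Prod.fst_add, Prod.snd_add, Pi.add_apply]
        module)
  have hf : Function.Surjective f := by
    rintro ⟨y, g, h⟩
    have ht : a * (c * y o) - c * (a * y o) = 0 := by ring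
    refine ⟨(c * y o, g, fun i => if (i : ℕ) = 0 then a * y o else y i, h), ?_⟩
    refine Prod.ext (funext fun i => ?_) (Prod.ext ?_ ?_)
    · by_cases hi : (i : ℕ) = 0
      · obtain rfl := ho i hi
        simp only [f, AddMonoidHom.mk'_apply, if_pos hi]
        linear_combination y o * hac
      · simp [f, hi]
    · simp [f, o, ht]
    · simp [f, o, ht]
  have hker : AddSubgroup.zmultiples
      ((u, r, fun i : Fin b => if (i : ℕ) = 0 then -w else 0, -s) : ℤ × G × (Fin b → ℤ) × H)
      = f.ker := by
    apply le_antisymm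
    · rw [AddSubgroup.zmultiples_le, AddMonoidHom.mem_ker]
      refine Prod.ext (funext fun i => ?_) (Prod.ext ?_ ?_)
      · by_cases hi : (i : ℕ) = 0
        · simp [f, o, hi]
          ring
        · simp [f, hi]
      · simp [f, o, hac]
      · simp [f, o, hac]
    · rintro ⟨n, g, x, h⟩ hp
      rw [AddMonoidHom.mem_ker] at hp
      simp only [f, AddMonoidHom.mk'_apply, Prod.mk_eq_zero] at hp
      obtain ⟨hx, hg, hh⟩ := hp
      have h0 : w * n + u * x o = 0 := by simpa [o] using congrFun hx o
      refine AddSubgroup.mem_zmultiples_iff.mpr ⟨a * n - c * x o, ?_⟩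
      refine Prod.ext ?_ (Prod.ext ?_ (Prod.ext (funext fun i => ?_) ?_))
      · simp only [Prod.smul_mk, smul_eq_mul]
        linear_combination n * hac - c * h0
      · exact (sub_eq_zero.mp hg).symm
      · by_cases hi : (i : ℕ) = 0
        · obtain rfl := ho i hi
          simp only [Prod.smul_mk, Pi.smul_apply, if_pos hi, smul_eq_mul]
          linear_combination x o * hac - a * h0
        · have := congrFun hx i
          simp only [if_neg hi] at this
          simp [hi, this]
      · simp only [Prod.smul_mk, smul_neg]
        exact (eq_neg_of_add_eq_zero_left hh).symm
  exact ⟨(QuotientAddGroup.quotientAddEquivOfEq hker).trans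
    (QuotientAddGroup.quotientKerEquivOfSurjective f hf)⟩
end

section
/- Let G and H be finite abelian groups, r ∈ G, s ∈ H, and let u, w be nonzero integers. The group homomorphism f : ℤ × G × ℤ × H → ℤ × G × H defined by f(x, g, y, h) = (wx + uy, w·g + y·r, x·s + u·h) vanishes on (u, r, −w, −s) and hence induces a group homomorphism f̄ : (ℤ × G × ℤ × H)/⟨(u, r, −w, −s)⟩ → ℤ × G × H. Then f̄ is surjective if and only if gcd(u, w) = 1, multiplication by w is surjective on G, and multiplication by u is surjective on H; and in that case f̄ is an isomorphism. -/
/-- The homomorphism `(x, g, y, h) ↦ (wx + uy, w·g + y·r, x·s + u·h)`. -/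
def crossHom {G H : Type*} [AddCommGroup G] [AddCommGroup H] (r : G) (s : H) (u w : ℤ) :
    ℤ × G × ℤ × H →+ ℤ × G × H where
  toFun p := (w * p.1 + u * p.2.2.1, w • p.2.1 + p.2.2.1 • r, p.1 • s + u • p.2.2.2)
  map_zero' := by simp
  map_add' p q := by
    simp only [Prod.fst_add, Prod.snd_add, Prod.mk_add_mk, Prod.mk.injEq]
    refine ⟨by ring, by module, by module⟩

/-- For coprime `u, w` with `u ≠ 0`, every solution of `wx + uy = 0` is a multiple
of `(u, -w)`. -/
lemma exists_eq_mul_of_add_eq_zero {u w x y : ℤ} (hu : u ≠ 0) (hgcd : Int.gcd u w = 1)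
    (h : w * x + u * y = 0) : ∃ k, x = k * u ∧ y = k * -w := by
  obtain ⟨k, rfl⟩ : u ∣ x :=
    (Int.isCoprime_iff_gcd_eq_one.2 hgcd).dvd_of_dvd_mul_left ⟨-y, by linarith⟩
  exact ⟨k, mul_comm u k, mul_left_cancel₀ hu (by linarith)⟩

/-- Let `G, H` be finite abelian groups, `r ∈ G`, `s ∈ H`, and `u, w` nonzero integers.
The homomorphism `f(x, g, y, h) = (wx + uy, w·g + y·r, x·s + u·h)` vanishes on
`(u, r, −w, −s)`, hence induces `f̄` on the quotient `(ℤ × G × ℤ × H)/⟨(u, r, −w, −s)⟩`.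
Then `f̄` is surjective iff `gcd(u, w) = 1`, multiplication by `w` is surjective on `G`,
and multiplication by `u` is surjective on `H`; and in that case `f̄` is an isomorphism. -/
theorem induced_hom_surjective_iff (G H : Type) [AddCommGroup G] [AddCommGroup H]
    [Finite G] [Finite H] (r : G) (s : H) (u w : ℤ) (hu : u ≠ 0) (hw : w ≠ 0) :
    ∃ fbar : ((ℤ × G × ℤ × H) ⧸ AddSubgroup.zmultiples
        ((u, r, -w, -s) : ℤ × G × ℤ × H)) →+ ℤ × G × H,
      (∀ (x : ℤ) (g : G) (y : ℤ) (h : H),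
        fbar (QuotientAddGroup.mk (x, g, y, h)) = (w * x + u * y, w • g + y • r, x • s + u • h)) ∧
      (Function.Surjective fbar ↔
        (Int.gcd u w = 1 ∧ Function.Surjective (fun g : G => w • g) ∧
          Function.Surjective (fun h : H => u • h))) ∧
      ((Int.gcd u w = 1 ∧ Function.Surjective (fun g : G => w • g) ∧
          Function.Surjective (fun h : H => u • h)) → Function.Bijective fbar) := by
  have hker : AddSubgroup.zmultiples ((u, r, -w, -s) : ℤ × G × ℤ × H) ≤
      (crossHom r s u w).ker := by
    rw [AddSubgroup.zmultiples_le, AddMonoidHom.mem_ker]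
    change (w * u + u * -w, w • r + -w • r, u • s + u • -s) = 0
    simp [mul_comm]
  set fbar := QuotientAddGroup.lift _ (crossHom r s u w) hker
  have hf (x : ℤ) (g : G) (y : ℤ) (h : H) : fbar (QuotientAddGroup.mk (x, g, y, h)) =
      (w * x + u * y, w • g + y • r, x • s + u • h) := rfl
  have hsurj (hcond : Int.gcd u w = 1 ∧ Function.Surjective (fun g : G => w • g) ∧
      Function.Surjective (fun h : H => u • h)) : Function.Surjective fbar := by
    obtain ⟨hgcd, hG, hH⟩ := hcond
    rintro ⟨a, b, c⟩
    obtain ⟨m, n, hmn⟩ := Int.isCoprime_iff_gcd_eq_one.2 hgcd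
    obtain ⟨g, hg⟩ := hG (b - (a * m) • r)
    obtain ⟨h, hh⟩ := hH (c - (a * n) • s)
    dsimp only at hg hh
    refine ⟨QuotientAddGroup.mk (a * n, g, a * m, h), ?_⟩
    rw [hf, hg, hh, sub_add_cancel, add_sub_cancel]
    congr 1
    linear_combination a * hmn
  refine ⟨fbar, hf, ⟨fun hs => ?_, hsurj⟩, fun hcond => ⟨?_, hsurj hcond⟩⟩
  · have hgcd : Int.gcd u w = 1 := by
      obtain ⟨q, hq⟩ := hs (1, 0, 0)
      obtain ⟨⟨x, g, y, h⟩, rfl⟩ := QuotientAddGroup.mk_surjective q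
      rw [hf, Prod.mk.injEq] at hq
      exact Int.isCoprime_iff_gcd_eq_one.1 ⟨y, x, by linarith [hq.1]⟩
    have hdiv (b : G) (c : H) : (∃ g : G, w • g = b) ∧ ∃ h : H, u • h = c := by
      obtain ⟨q, hq⟩ := hs (0, b, c)
      obtain ⟨⟨x, g, y, h⟩, rfl⟩ := QuotientAddGroup.mk_surjective q
      simp only [hf, Prod.mk.injEq] at hq
      obtain ⟨hxy, rfl, rfl⟩ := hq
      obtain ⟨k, rfl, rfl⟩ := exists_eq_mul_of_add_eq_zero hu hgcd hxy
      exact ⟨⟨g - k • r, by module⟩, ⟨h + k • s, by module⟩⟩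
    exact ⟨hgcd, fun b => (hdiv b 0).1, fun c => (hdiv 0 c).2⟩
  · obtain ⟨hgcd, hG, hH⟩ := hcond
    rw [injective_iff_map_eq_zero]
    intro q hq
    obtain ⟨⟨x, g, y, h⟩, rfl⟩ := QuotientAddGroup.mk_surjective q
    simp only [hf, Prod.mk_eq_zero] at hq
    obtain ⟨hxy, hg, hh⟩ := hq
    obtain ⟨k, rfl, rfl⟩ := exists_eq_mul_of_add_eq_zero hu hgcd hxy
    have hg' : g = k • r := Finite.injective_iff_surjective.2 hG <| by
      rw [← sub_eq_zero, ← hg]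
      module
    have hh' : h = k • -s := Finite.injective_iff_surjective.2 hH <| by
      rw [← sub_eq_zero, ← hh]
      module
    rw [QuotientAddGroup.eq_zero_iff, AddSubgroup.mem_zmultiples_iff]
    exact ⟨k, by simp [hg', hh']⟩
end

section
/- Let b ≥ 2 be an integer, let G and H be finite abelian groups, r ∈ G, s ∈ H, and let u, w be nonzero integers. The group homomorphism f : ℤ × G × ℤᵇ × H → ℤᵇ × Gᵇ × H defined by f(x, g, (y₁, …, y_b), h) = ((wx + uy₁, uy₂, …, uy_b), (w·g + y₁·r, y₂·r, …, y_b·r), x·s + u·h) vanishes on (u, r, (−w, 0, …, 0), −s) and hence induces a group homomorphism f̄ on the quotient (ℤ × G × ℤᵇ × H)/⟨(u, r, (−w, 0, …, 0), −s)⟩. If f̄ is surjective, then G is trivial, gcd(u, w) = 1, and multiplication by u is surjective on H. -/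
/-- The homomorphism `(x, g, y, h) ↦ (w x e₀ + u y, w g e₀ + y r, x s + u h)`, where `e₀` places
its argument in the zeroth coordinate. -/
def inducedHomAux (b : ℕ) {G H : Type*} [AddCommGroup G] [AddCommGroup H]
    (r : G) (s : H) (u w : ℤ) :
    ℤ × G × (Fin b → ℤ) × H →+ (Fin b → ℤ) × (Fin b → G) × H where
  toFun p :=
    (fun i => if (i : ℕ) = 0 then w * p.1 + u * p.2.2.1 i else u * p.2.2.1 i,
     fun i => if (i : ℕ) = 0 then w • p.2.1 + (p.2.2.1 i) • r else (p.2.2.1 i) • r,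
     p.1 • s + u • p.2.2.2)
  map_zero' := by
    ext <;> simp
  map_add' p q := by
    refine Prod.ext (funext fun i => ?_) (Prod.ext (funext fun i => ?_) ?_)
    · simp only [Prod.fst_add, Prod.snd_add, Pi.add_apply]
      split_ifs <;> ring
    · simp only [Prod.fst_add, Prod.snd_add, Pi.add_apply]
      split_ifs <;> module
    · simp only [Prod.fst_add, Prod.snd_add]
      module

theorem inducedHomAux_relation (b : ℕ) {G H : Type*} [AddCommGroup G] [AddCommGroup H]
    (r : G) (s : H) (u w : ℤ) :
    inducedHomAux b r s u w
      (u, r, fun i : Fin b => if (i : ℕ) = 0 then -w else 0, -s) = 0 := by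
  refine Prod.ext (funext fun i => ?_) (Prod.ext (funext fun i => ?_) ?_)
  · by_cases hi : (i : ℕ) = 0
    · simp [inducedHomAux, hi, mul_comm]
    · simp [inducedHomAux, hi]
  · by_cases hi : (i : ℕ) = 0 <;> simp [inducedHomAux, hi]
  · simp [inducedHomAux]

/-- Let `b ≥ 2`, `G, H` finite abelian groups, `r ∈ G`, `s ∈ H`, and `u, w` nonzero
integers.  The homomorphism
`f(x, g, (y₁, …, y_b), h) = ((wx + uy₁, uy₂, …, uy_b), (w·g + y₁·r, y₂·r, …, y_b·r), x·s + u·h)`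
vanishes on `(u, r, (−w, 0, …, 0), −s)` and induces `f̄` on the quotient
`(ℤ × G × ℤᵇ × H)/⟨(u, r, (−w, 0, …, 0), −s)⟩`.  If `f̄` is surjective, then `G` is
trivial, `gcd(u, w) = 1`, and multiplication by `u` is surjective on `H`. -/
theorem induced_hom_surjective_consequences (b : ℕ) (hb : 2 ≤ b)
    (G H : Type) [AddCommGroup G] [AddCommGroup H] [Finite G] [Finite H]
    (r : G) (s : H) (u w : ℤ) (hu : u ≠ 0) (hw : w ≠ 0) :
    ∃ fbar : ((ℤ × G × (Fin b → ℤ) × H) ⧸ AddSubgroup.zmultiples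
        ((u, r, fun i : Fin b => if (i : ℕ) = 0 then -w else 0, -s)
          : ℤ × G × (Fin b → ℤ) × H)) →+ (Fin b → ℤ) × (Fin b → G) × H,
      (∀ (x : ℤ) (g : G) (y : Fin b → ℤ) (h : H),
        fbar (QuotientAddGroup.mk (x, g, y, h)) =
          (fun i : Fin b => if (i : ℕ) = 0 then w * x + u * y i else u * y i,
           fun i : Fin b => if (i : ℕ) = 0 then w • g + (y i) • r else (y i) • r,
           x • s + u • h)) ∧
      (Function.Surjective fbar →
        ((∀ g : G, g = 0) ∧ Int.gcd u w = 1 ∧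
          Function.Surjective (fun h : H => u • h))) := by
  refine ⟨QuotientAddGroup.lift _ (inducedHomAux b r s u w) ?_, fun x g y h => rfl, ?_⟩
  · rw [AddSubgroup.zmultiples_le]
    exact inducedHomAux_relation b r s u w
  · intro hsurj
    have key (z : Fin b → ℤ) (k : Fin b → G) :
        ∃ n : ℤ, u * n = z ⟨1, hb⟩ ∧ n • r = k ⟨1, hb⟩ := by
      obtain ⟨q, hq⟩ := hsurj (z, k, 0)
      obtain ⟨⟨x, g, y, h⟩, rfl⟩ := QuotientAddGroup.mk_surjective q
      exact ⟨y ⟨1, hb⟩, congrFun (congrArg Prod.fst hq) ⟨1, hb⟩,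
        congrFun (congrArg (fun p => p.2.1) hq) ⟨1, hb⟩⟩
    obtain ⟨n, hn, -⟩ := key (fun _ => 1) 0
    refine ⟨fun g => ?_, ?_, fun h => ⟨n • h, ?_⟩⟩
    · obtain ⟨m, hm, hg⟩ := key 0 (fun _ => g)
      have hm0 : m = 0 := (mul_eq_zero.mp hm).resolve_left hu
      simpa [hm0] using hg.symm
    · exact Int.isCoprime_iff_gcd_eq_one.mp
        ⟨n, 0, by rw [zero_mul, add_zero, mul_comm, hn]⟩
    · change u • n • h = h
      rw [smul_smul, hn, one_smul]
end

section
/- Let D be the unital C*-algebra of all continuous functions f : [0,1] → M₂(ℂ) such that f(0) and f(1) are diagonal matrices. Let P ∈ D be the constant function with value the matrix [[1,0],[0,0]], and let Q ∈ D be given by Q(t) = [[t, √(t(1−t))],[√(t(1−t)), 1−t]]. Then P and Q are projections in D, and for every unital C*-algebra B and every pair of projections p, q ∈ B there is a unique unital star-algebra homomorphism φ : D → B with φ(P) = p and φ(Q) = q. (Thus D is the universal unital C*-algebra generated by two projections, ℂ² *_ℂ ℂ².) -/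
namespace TwoProj

/-- The function `t ↦ √(t(1-t))`. -/
noncomputable def offDiag : C(unitInterval, ℂ) :=
  ⟨fun t => (Real.sqrt ((t : ℝ) * (1 - (t : ℝ))) : ℂ), by fun_prop⟩

/-- The function `t ↦ t`. -/
noncomputable def coord : C(unitInterval, ℂ) := ⟨fun t => ((t : ℝ) : ℂ), by fun_prop⟩

lemma offDiag_mul_self : offDiag * offDiag = coord * (1 - coord) := by
  ext t
  have h : 0 ≤ (t : ℝ) * (1 - (t : ℝ)) := mul_nonneg t.2.1 (sub_nonneg.2 t.2.2)
  simp only [offDiag, coord, ContinuousMap.mul_apply, ContinuousMap.coe_mk,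
    ContinuousMap.sub_apply, ContinuousMap.one_apply]
  rw [← Complex.ofReal_mul, Real.mul_self_sqrt h]
  push_cast
  ring

lemma star_offDiag : star offDiag = offDiag := by
  ext t
  simp [offDiag]

/-- Continuous matrix-valued functions on `[0,1]`, recorded as quadruples of entries
`(f₀₀, f₀₁, f₁₀, f₁₁)`. -/
abbrev Entries : Type :=
  C(unitInterval, ℂ) × C(unitInterval, ℂ) × C(unitInterval, ℂ) × C(unitInterval, ℂ)

/-- The matrix-valued function with the given entries. -/
noncomputable def ofEntries (v : Entries) : C(unitInterval, Matrix (Fin 2) (Fin 2) ℂ) :=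
  ⟨fun t => !![v.1 t, v.2.1 t; v.2.2.1 t, v.2.2.2 t], by fun_prop⟩

/-- An entry of a matrix-valued function. -/
noncomputable def entry (i j : Fin 2) (f : C(unitInterval, Matrix (Fin 2) (Fin 2) ℂ)) : C(unitInterval, ℂ) :=
  ⟨fun t => f t i j, by fun_prop⟩

/-- All entries of a matrix-valued function. -/
noncomputable def entries (f : C(unitInterval, Matrix (Fin 2) (Fin 2) ℂ)) : Entries :=
  (entry 0 0 f, entry 0 1 f, entry 1 0 f, entry 1 1 f)

/-- Matrix multiplication in terms of entries. -/
noncomputable def mulEntries (v w : Entries) : Entries :=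
  (v.1 * w.1 + v.2.1 * w.2.2.1, v.1 * w.2.1 + v.2.1 * w.2.2.2,
    v.2.2.1 * w.1 + v.2.2.2 * w.2.2.1, v.2.2.1 * w.2.1 + v.2.2.2 * w.2.2.2)

/-- Conjugate transposition in terms of entries. -/
noncomputable def starEntries (v : Entries) : Entries :=
  (star v.1, star v.2.2.1, star v.2.1, star v.2.2.2)

lemma ofEntries_entries (f : C(unitInterval, Matrix (Fin 2) (Fin 2) ℂ)) :
    ofEntries (entries f) = f := by
  ext t i j
  fin_cases i <;> fin_cases j <;> simp [ofEntries, entries, entry]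

lemma entries_mul (f g : C(unitInterval, Matrix (Fin 2) (Fin 2) ℂ)) :
    entries (f * g) = mulEntries (entries f) (entries g) := by
  simp only [entries, mulEntries, Prod.mk.injEq]
  refine ⟨?_, ?_, ?_, ?_⟩ <;> ext t <;> simp [entry, Matrix.mul_apply]

lemma entries_star (f : C(unitInterval, Matrix (Fin 2) (Fin 2) ℂ)) :
    entries (star f) = starEntries (entries f) := by
  simp only [entries, starEntries, Prod.mk.injEq]
  refine ⟨?_, ?_, ?_, ?_⟩ <;> ext t <;> simp [entry, Matrix.star_apply]

/-- The quadruples of entries of elements of `twoProjAlgebra`: both off-diagonal entries vanish at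
the endpoints. -/
def diagAtEnds : Submodule ℂ Entries where
  carrier := {v | (v.2.1 0 = 0 ∧ v.2.1 1 = 0) ∧ v.2.2.1 0 = 0 ∧ v.2.2.1 1 = 0}
  add_mem' := by
    rintro v w ⟨⟨h₁, h₂⟩, h₃, h₄⟩ ⟨⟨k₁, k₂⟩, k₃, k₄⟩
    simp [h₁, h₂, h₃, h₄, k₁, k₂, k₃, k₄]
  zero_mem' := by simp
  smul_mem' := by
    rintro c v ⟨⟨h₁, h₂⟩, h₃, h₄⟩
    simp [h₁, h₂, h₃, h₄]

lemma mem_diagAtEnds {v : Entries} : v ∈ diagAtEnds ↔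
    (v.2.1 0 = 0 ∧ v.2.1 1 = 0) ∧ v.2.2.1 0 = 0 ∧ v.2.2.1 1 = 0 := Iff.rfl

instance : IsBoundedSMul ℂ diagAtEnds := (Submodule.normedSpace diagAtEnds).toIsBoundedSMul

lemma entries_mem {f : C(unitInterval, Matrix (Fin 2) (Fin 2) ℂ)} (hf : f ∈ twoProjAlgebra) :
    entries f ∈ diagAtEnds :=
  ⟨⟨hf.1 (by decide), hf.2 (by decide)⟩, hf.1 (by decide), hf.2 (by decide)⟩

lemma ofEntries_mem {v : Entries} (hv : v ∈ diagAtEnds) : ofEntries v ∈ twoProjAlgebra := by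
  obtain ⟨⟨h₁, h₂⟩, h₃, h₄⟩ := hv
  constructor <;> intro i j hij <;> fin_cases i <;> fin_cases j <;>
    simp_all [ofEntries]

lemma mulEntries_mem {v w : Entries} (hv : v ∈ diagAtEnds) (hw : w ∈ diagAtEnds) :
    mulEntries v w ∈ diagAtEnds := by
  obtain ⟨⟨h₁, h₂⟩, h₃, h₄⟩ := hv
  obtain ⟨⟨k₁, k₂⟩, k₃, k₄⟩ := hw
  simp [mem_diagAtEnds, mulEntries, h₁, h₂, h₃, h₄, k₁, k₂, k₃, k₄]

lemma starEntries_mem {v : Entries} (hv : v ∈ diagAtEnds) : starEntries v ∈ diagAtEnds := by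
  obtain ⟨⟨h₁, h₂⟩, h₃, h₄⟩ := hv
  simp [mem_diagAtEnds, starEntries, h₁, h₂, h₃, h₄]

/-- Multiply the off-diagonal entries by `√(t(1-t))`. -/
noncomputable def scale : Entries →ₗ[ℂ] diagAtEnds where
  toFun v := ⟨(v.1, offDiag * v.2.1, offDiag * v.2.2.1, v.2.2.2), by
    simp [mem_diagAtEnds, offDiag]⟩
  map_add' v w := by
    ext1
    simp [mul_add]
  map_smul' c v := by
    ext1
    simp [mul_smul_comm]

lemma coe_scale (v : Entries) :
    (scale v : Entries) = (v.1, offDiag * v.2.1, offDiag * v.2.2.1, v.2.2.2) := rfl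

/-- The product on quadruples that `scale` turns into matrix multiplication. -/
noncomputable def scaledMul (v w : Entries) : Entries :=
  (v.1 * w.1 + offDiag * offDiag * (v.2.1 * w.2.2.1), v.1 * w.2.1 + v.2.1 * w.2.2.2,
    v.2.2.1 * w.1 + v.2.2.2 * w.2.2.1,
    offDiag * offDiag * (v.2.2.1 * w.2.1) + v.2.2.2 * w.2.2.2)

lemma scale_scaledMul (v w : Entries) :
    (scale (scaledMul v w) : Entries) = mulEntries (scale v) (scale w) := by
  simp only [coe_scale, scaledMul, mulEntries, Prod.mk.injEq]
  refine ⟨?_, ?_, ?_, ?_⟩ <;> ring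

lemma scale_starEntries (v : Entries) :
    (scale (starEntries v) : Entries) = starEntries (scale v) := by
  simp [coe_scale, starEntries, star_offDiag]

lemma mem_closure_range_offDiag_mul {b : C(unitInterval, ℂ)} (h₀ : b 0 = 0) (h₁ : b 1 = 0) :
    b ∈ closure (Set.range fun g => offDiag * g) := by
  have h : b ∈ (Ideal.span {offDiag}).closure := by
    rw [← ContinuousMap.idealOfSet_ofIdeal_eq_closure, ContinuousMap.mem_idealOfSet]
    intro t ht
    have ht' := ContinuousMap.notMem_setOfIdeal.1 ht (Ideal.mem_span_singleton_self offDiag)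
    have hnn : 0 ≤ (t : ℝ) * (1 - (t : ℝ)) := mul_nonneg t.2.1 (sub_nonneg.2 t.2.2)
    simp only [offDiag, ContinuousMap.coe_mk, Complex.ofReal_eq_zero, Real.sqrt_eq_zero hnn,
      mul_eq_zero, sub_eq_zero] at ht'
    rcases ht' with ht' | ht'
    · rwa [show t = 0 from Subtype.ext ht']
    · rwa [show t = 1 from Subtype.ext ht'.symm]
  have h' : b ∈ closure ((Ideal.span {offDiag} : Ideal C(unitInterval, ℂ)) : Set _) := h
  refine closure_mono ?_ h'
  intro f hf
  obtain ⟨g, rfl⟩ := Ideal.mem_span_singleton.1 hf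
  exact ⟨g, rfl⟩

lemma denseRange_scale : DenseRange scale := by
  rw [DenseRange, Subtype.dense_iff]
  rintro ⟨a, b, c, d⟩ ⟨⟨h₁, h₂⟩, h₃, h₄⟩
  refine map_mem_closure₂ (f := fun b c => ((a, b, c, d) : Entries)) (by fun_prop)
    (mem_closure_range_offDiag_mul h₁ h₂) (mem_closure_range_offDiag_mul h₃ h₄) ?_
  rintro _ ⟨g, rfl⟩ _ ⟨h, rfl⟩
  exact ⟨scale (a, g, h, d), ⟨_, rfl⟩, rfl⟩

section CStar

variable {B : Type*} [CStarAlgebra B]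

lemma hom_continuous (H : C(unitInterval, ℂ) →⋆ₐ[ℂ] B) : Continuous H :=
  AddMonoidHomClass.continuous_of_bound H 1
    (by simpa only [one_mul] using NonUnitalStarAlgHom.norm_apply_le H)

/-- A star subalgebra of `C([0,1])` that is closed and contains the coordinate is everything. -/
lemma eq_top_of_coord_mem {S : StarSubalgebra ℂ C(unitInterval, ℂ)}
    (hS : IsClosed (S : Set C(unitInterval, ℂ))) (h : coord ∈ S) : S = ⊤ := by
  have hsep : S.SeparatesPoints := by
    intro t u htu
    refine ⟨coord, ⟨coord, h, rfl⟩, ?_⟩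
    simpa [coord, Subtype.ext_iff] using htu
  rw [← ContinuousMap.starSubalgebra_topologicalClosure_eq_top_of_separatesPoints S hsep]
  exact SetLike.coe_injective hS.closure_eq.symm

lemma hom_ext {H K : C(unitInterval, ℂ) →⋆ₐ[ℂ] B} (h : H coord = K coord) : H = K := by
  have : StarAlgHom.equalizer H K = ⊤ :=
    eq_top_of_coord_mem (isClosed_eq (hom_continuous H) (hom_continuous K)) h
  ext f
  exact (this.symm ▸ trivial : f ∈ StarAlgHom.equalizer H K)

lemma commute_hom (H : C(unitInterval, ℂ) →⋆ₐ[ℂ] B) {z : B} (hz : star z = z)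
    (h : Commute (H coord) z) (f : C(unitInterval, ℂ)) : Commute (H f) z := by
  have key : (StarSubalgebra.centralizer ℂ {z}).comap H = ⊤ := by
    refine eq_top_of_coord_mem ?_ ?_
    · have : ((StarSubalgebra.centralizer ℂ {z}).comap H : Set C(unitInterval, ℂ)) =
          {f | z * H f = H f * z} := by
        ext f
        rw [SetLike.mem_coe, StarSubalgebra.mem_comap, StarSubalgebra.mem_centralizer_iff]
        simp [hz]
      rw [this]
      have := hom_continuous H
      exact isClosed_eq (by fun_prop) (by fun_prop)
    · rw [StarSubalgebra.mem_comap, StarSubalgebra.mem_centralizer_iff]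
      simpa [hz] using h.eq.symm
  have hf : f ∈ (StarSubalgebra.centralizer ℂ {z}).comap H := key.symm ▸ trivial
  have := (StarSubalgebra.mem_centralizer_iff ℂ).1 hf z rfl
  exact this.1.symm

lemma norm_le_of_mul_star_eq (H : C(unitInterval, ℂ) →⋆ₐ[ℂ] B) {b : C(unitInterval, ℂ)} {u w : B}
    (h : w * star w = H (b * star b) * u) : ‖w‖ ≤ (‖u‖ + 1) * ‖b‖ := by
  refine le_of_sq_le_sq ?_ (by positivity)
  calc ‖w‖ ^ 2 = ‖w * star w‖ := by rw [CStarRing.norm_self_mul_star, sq]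
    _ ≤ ‖H (b * star b)‖ * ‖u‖ := h ▸ norm_mul_le _ _
    _ ≤ ‖b * star b‖ * ‖u‖ := by
      gcongr
      exact NonUnitalStarAlgHom.norm_apply_le H _
    _ = ‖b‖ ^ 2 * ‖u‖ := by
      rw [show ‖b * star b‖ = ‖b‖ * ‖b‖ from CStarRing.norm_self_mul_star, sq]
    _ ≤ ((‖u‖ + 1) * ‖b‖) ^ 2 := by
      rw [mul_pow, mul_comm]
      gcongr
      nlinarith [norm_nonneg u]

lemma exists_hom {p q : B} (hp : star p = p) (hpp : p * p = p)
    (hq : star q = q) (hqq : q * q = q) :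
    ∃ H : C(unitInterval, ℂ) →⋆ₐ[ℂ] B, H coord = 1 - (p - q) * (p - q) := by
  set x : B := 1 - (p - q) * (p - q) with hx
  have hxs : IsSelfAdjoint x := by
    simp [hx, IsSelfAdjoint, hp, hq]
  have hn : IsStarNormal x := hxs.isStarNormal
  have h0 : ∀ r ∈ spectrum ℝ x, 0 ≤ r := by
    have : x = star (q * p + (1 - q) * (1 - p)) * (q * p + (1 - q) * (1 - p)) := by
      have hq' : ∀ z, q * (q * z) = q * z := fun z => by rw [← mul_assoc, hqq]
      simp only [hx, star_add, star_mul, star_sub, star_one, hp, hq, mul_add, add_mul, mul_sub,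
        sub_mul, mul_assoc, hpp, hqq, hq', one_mul, mul_one]
      abel
    rw [this]
    exact spectrum_star_mul_self_nonneg
  have h1 : ∀ r ∈ spectrum ℝ x, r ≤ 1 := by
    intro r hr
    have h : ∀ r ∈ spectrum ℝ (star (p - q) * (p - q)), 0 ≤ r := spectrum_star_mul_self_nonneg
    have : (1 - r) ∈ spectrum ℝ (star (p - q) * (p - q)) := by
      have : star (p - q) * (p - q) = algebraMap ℝ B 1 - x := by simp [hx, hp, hq]
      rw [this, ← spectrum.singleton_sub_eq]
      exact ⟨1, rfl, r, hr, rfl⟩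
    linarith [h _ this]
  let r : C(spectrum ℂ x, unitInterval) :=
    ⟨fun z => Set.projIcc 0 1 zero_le_one (z : ℂ).re, by fun_prop⟩
  refine ⟨(cfcHom hn).comp (ContinuousMap.compStarAlgHom' ℂ ℂ r), ?_⟩
  have : coord.comp r = (ContinuousMap.id ℂ).restrict (spectrum ℂ x) := by
    ext z
    have hz := hxs.mem_spectrum_eq_re z.2
    have hz' : (z : ℂ).re ∈ spectrum ℝ x := by
      rw [← spectrum.algebraMap_mem_iff ℂ]
      rw [Complex.coe_algebraMap, ← hz]
      exact z.2
    simp only [coord, r, ContinuousMap.comp_apply, ContinuousMap.coe_mk]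
    rw [Set.projIcc_of_mem _ ⟨h0 _ hz', h1 _ hz'⟩]
    exact hz.symm
  change cfcHom hn (coord.comp r) = x
  rw [this, cfcHom_id]

/-- The linear map induced by `p` and `y` on rescaled entries: it sends `(a, g, h, d)` to
`a p + g y + h y* + d (1 - p)`, where scalar functions act through `H`. -/
noncomputable def scaledHom (H : C(unitInterval, ℂ) →⋆ₐ[ℂ] B) (p y : B) : Entries →ₗ[ℂ] B where
  toFun v := H v.1 * p + H v.2.1 * y + H v.2.2.1 * star y + H v.2.2.2 * (1 - p)
  map_add' v w := by
    simp only [Prod.fst_add, Prod.snd_add, map_add, add_mul]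
    abel
  map_smul' c v := by
    simp [smul_add]

lemma scaledHom_apply (H : C(unitInterval, ℂ) →⋆ₐ[ℂ] B) (p y : B) (v : Entries) :
    scaledHom H p y v =
      H v.1 * p + H v.2.1 * y + H v.2.2.1 * star y + H v.2.2.2 * (1 - p) := rfl

section Relations

variable {H : C(unitInterval, ℂ) →⋆ₐ[ℂ] B} {p y : B}

lemma scaledHom_scaledMul (hpp : p * p = p) (hp : star p = p) (hpy : p * y = y) (hyp : y * p = 0)
    (hyy : y * star y = H (offDiag * offDiag) * p)
    (hyy' : star y * y = H (offDiag * offDiag) * (1 - p))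
    (hHp : ∀ f, Commute (H f) p) (hHy : ∀ f, Commute (H f) y) (v w : Entries) :
    scaledHom H p y (scaledMul v w) = scaledHom H p y v * scaledHom H p y w := by
  have hpsy : p * star y = 0 := by simpa [hp] using congrArg star hyp
  have hsyp : star y * p = star y := by simpa [hp] using congrArg star hpy
  have hy2 : y * y = 0 := by
    rw [← hpy, mul_assoc, ← mul_assoc y, hyp, zero_mul, mul_zero]
  have hsy2 : star y * star y = 0 := by rw [← star_mul, hy2, star_zero]
  have hHsy : ∀ f, Commute (H f) (star y) := fun f => by
    simpa [← map_star] using (hHy (star f)).star_star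
  have hHp' : ∀ f, Commute (H f) (1 - p) := fun f => (Commute.one_right _).sub_right (hHp f)
  have key : ∀ {u : B}, (∀ f, Commute (H f) u) → ∀ (f g) (z : B),
      H f * u * (H g * z) = H (f * g) * (u * z) := fun {u} hu f g z => by
    rw [map_mul, mul_assoc, ← mul_assoc u, ← (hu g).eq, mul_assoc, mul_assoc]
  have e₁ : p * (1 - p) = 0 := by rw [mul_sub, mul_one, hpp, sub_self]
  have e₂ : (1 - p) * p = 0 := by rw [sub_mul, one_mul, hpp, sub_self]
  have e₃ : (1 - p) * (1 - p) = 1 - p := by rw [mul_sub, e₂, mul_one, sub_zero]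
  have e₄ : (1 - p) * y = 0 := by rw [sub_mul, hpy, one_mul, sub_self]
  have e₅ : y * (1 - p) = y := by rw [mul_sub, hyp, mul_one, sub_zero]
  have e₆ : (1 - p) * star y = star y := by rw [sub_mul, hpsy, one_mul, sub_zero]
  have e₇ : star y * (1 - p) = 0 := by rw [mul_sub, hsyp, mul_one, sub_self]
  simp only [scaledHom_apply, mul_add, add_mul, key hHp, key hHp', key hHy, key hHsy, hpp, e₁, e₂,
    e₃, e₄, e₅, e₆, e₇, hpy, hyp, hpsy, hsyp, hy2, hsy2, hyy, hyy', mul_zero, add_zero, zero_add]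
  simp only [scaledMul, map_add, add_mul, ← mul_assoc, ← map_mul]
  simp only [mul_comm, mul_left_comm]
  abel

lemma scaledHom_starEntries (hp : star p = p) (hHp : ∀ f, Commute (H f) p)
    (hHy : ∀ f, Commute (H f) y) (v : Entries) :
    scaledHom H p y (starEntries v) = star (scaledHom H p y v) := by
  have hHsy : ∀ f, Commute (H f) (star y) := fun f => by
    simpa [← map_star] using (hHy (star f)).star_star
  have hHp' : ∀ f, Commute (H f) (1 - p) := fun f => (Commute.one_right _).sub_right (hHp f)
  simp only [scaledHom_apply, starEntries, star_add, star_mul, star_sub, star_one, hp, star_star,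
    ← map_star, ← (hHp _).eq, ← (hHp' _).eq, ← (hHy _).eq, ← (hHsy _).eq]
  abel

lemma norm_scaledHom_le
    (hyy : y * star y = H (offDiag * offDiag) * p)
    (hyy' : star y * y = H (offDiag * offDiag) * (1 - p))
    (hHp : ∀ f, Commute (H f) p) (v : Entries) :
    ‖scaledHom H p y v‖ ≤ (2 * ‖p‖ + 2 * ‖1 - p‖ + 2) * ‖scale v‖ := by
  have hHp' : ∀ f, Commute (H f) (1 - p) := fun f => (Commute.one_right _).sub_right (hHp f)
  have key : ∀ {z u : B}, z * star z = H (offDiag * offDiag) * u → (∀ f, Commute (H f) u) →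
      ∀ g, ‖H g * z‖ ≤ (‖u‖ + 1) * ‖offDiag * g‖ := by
    intro z u hz hu g
    refine norm_le_of_mul_star_eq H ?_
    calc H g * z * star (H g * z) = H g * (z * star z) * H (star g) := by
          simp only [star_mul, map_star, mul_assoc]
      _ = H g * H (offDiag * offDiag) * H (star g) * u := by
          rw [hz, mul_assoc, mul_assoc, ← (hu _).eq, mul_assoc, mul_assoc]
      _ = H (offDiag * g * star (offDiag * g)) * u := by
          rw [← map_mul, ← map_mul, star_mul, star_offDiag]
          congr 2
          ring
  have scal : ∀ (f) (u : B), ‖H f * u‖ ≤ ‖u‖ * ‖f‖ := fun f u => by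
    rw [mul_comm ‖u‖]
    refine (norm_mul_le _ _).trans ?_
    gcongr
    exact NonUnitalStarAlgHom.norm_apply_le H f
  have n₁ : ‖v.1‖ ≤ ‖scale v‖ := norm_fst_le (scale v : Entries)
  have n' : ‖(scale v : Entries).2‖ ≤ ‖scale v‖ := norm_snd_le (scale v : Entries)
  have n₂ : ‖offDiag * v.2.1‖ ≤ ‖scale v‖ := (norm_fst_le (scale v : Entries).2).trans n'
  have n'' : ‖(scale v : Entries).2.2‖ ≤ ‖scale v‖ := (norm_snd_le (scale v : Entries).2).trans n'
  have n₃ : ‖offDiag * v.2.2.1‖ ≤ ‖scale v‖ := (norm_fst_le (scale v : Entries).2.2).trans n''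
  have n₄ : ‖v.2.2.2‖ ≤ ‖scale v‖ := (norm_snd_le (scale v : Entries).2.2).trans n''
  calc ‖scaledHom H p y v‖
      ≤ ‖H v.1 * p‖ + ‖H v.2.1 * y‖ + ‖H v.2.2.1 * star y‖ + ‖H v.2.2.2 * (1 - p)‖ := by
        rw [scaledHom_apply]
        exact norm_add₄_le
    _ ≤ ‖p‖ * ‖scale v‖ + (‖p‖ + 1) * ‖scale v‖ + (‖1 - p‖ + 1) * ‖scale v‖
          + ‖1 - p‖ * ‖scale v‖ := by
        gcongr
        · exact (scal _ _).trans (by gcongr)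
        · exact (key hyy hHp _).trans (by gcongr)
        · exact (key (by rwa [star_star]) hHp' _).trans (by gcongr)
        · exact (scal _ _).trans (by gcongr)
    _ = _ := by ring

lemma exists_starAlgHom (hpp : p * p = p) (hp : star p = p) (hpy : p * y = y) (hyp : y * p = 0)
    (hyy : y * star y = H (offDiag * offDiag) * p)
    (hyy' : star y * y = H (offDiag * offDiag) * (1 - p))
    (hHp : ∀ f, Commute (H f) p) (hHy : ∀ f, Commute (H f) y) :
    ∃ φ : twoProjAlgebra →⋆ₐ[ℂ] B, ∀ (f : twoProjAlgebra) (v : Entries),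
      entries f = scale v → φ f = scaledHom H p y v := by
  set Φ : diagAtEnds →L[ℂ] B := (scaledHom H p y).extendOfNorm (Eₗ := diagAtEnds) scale
  have hΦv : ∀ v, Φ (scale v) = scaledHom H p y v := fun v =>
    LinearMap.extendOfNorm_eq denseRange_scale ⟨_, norm_scaledHom_le hyy hyy' hHp⟩ v
  have hmul : ∀ v w : diagAtEnds,
      Φ ⟨mulEntries v w, mulEntries_mem v.2 w.2⟩ = Φ v * Φ w := by
    intro v w
    refine denseRange_scale.induction_on₂
      (p := fun v w : diagAtEnds => Φ ⟨mulEntries v w, mulEntries_mem v.2 w.2⟩ = Φ v * Φ w) ?_ ?_ v w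
    · refine isClosed_eq (Φ.continuous.comp (Continuous.subtype_mk ?_ _)) (by fun_prop)
      unfold mulEntries
      fun_prop
    · intro v w
      rw [hΦv, hΦv, ← scaledHom_scaledMul hpp hp hpy hyp hyy hyy' hHp hHy, ← hΦv]
      exact congrArg Φ (Subtype.ext (scale_scaledMul v w).symm)
  have hstar : ∀ v : diagAtEnds,
      Φ ⟨starEntries v, starEntries_mem v.2⟩ = star (Φ v) := by
    intro v
    refine denseRange_scale.induction_on
      (p := fun v : diagAtEnds => Φ ⟨starEntries v, starEntries_mem v.2⟩ = star (Φ v)) v ?_ ?_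
    · refine isClosed_eq (Φ.continuous.comp (Continuous.subtype_mk ?_ _)) (by fun_prop)
      unfold starEntries
      fun_prop
    · intro v
      rw [hΦv, ← scaledHom_starEntries hp hHp hHy, ← hΦv]
      exact congrArg Φ (Subtype.ext (scale_starEntries v).symm)
  have hval : ∀ (f : twoProjAlgebra) (v : Entries), entries f = scale v →
      Φ ⟨entries f, entries_mem f.2⟩ = scaledHom H p y v := by
    intro f v h
    rw [← hΦv]
    exact congrArg Φ (Subtype.ext h)
  have halg : ∀ c : ℂ, Φ ⟨entries (algebraMap ℂ twoProjAlgebra c : twoProjAlgebra),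
      entries_mem (algebraMap ℂ twoProjAlgebra c).2⟩ = algebraMap ℂ B c := by
    intro c
    rw [hval _ (algebraMap ℂ _ c, 0, 0, algebraMap ℂ _ c)]
    · simp only [scaledHom_apply, map_zero, zero_mul, add_zero, AlgHomClass.commutes]
      rw [← mul_add, add_sub_cancel, mul_one]
    · simp only [entries, coe_scale, mul_zero, Prod.mk.injEq]
      refine ⟨?_, ?_, ?_, ?_⟩ <;> ext t <;>
        simp [entry]
  refine ⟨{
    toFun := fun f => Φ ⟨entries f, entries_mem f.2⟩
    map_one' := by simpa using halg 1
    map_mul' := fun f g => by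
      rw [← hmul]
      exact congrArg Φ (Subtype.ext (entries_mul f g))
    map_zero' := by simpa using halg 0
    map_add' := fun f g => by
      rw [← map_add]
      exact congrArg Φ (Subtype.ext rfl)
    commutes' := halg
    map_star' := fun f => by
      rw [← hstar]
      exact congrArg Φ (Subtype.ext (entries_star f)) }, hval⟩

end Relations

/-- The constant projection onto the first coordinate. -/
noncomputable def projP : twoProjAlgebra :=
  ⟨ofEntries (1, 0, 0, 0), ofEntries_mem (by simp [mem_diagAtEnds])⟩

/-- The constant projection onto the second coordinate. -/
noncomputable def projPCompl : twoProjAlgebra :=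
  ⟨ofEntries (0, 0, 0, 1), ofEntries_mem (by simp [mem_diagAtEnds])⟩

/-- The projection `t ↦ [[t, √(t(1-t))], [√(t(1-t)), 1-t]]`. -/
noncomputable def projQ : twoProjAlgebra :=
  ⟨ofEntries (coord, offDiag, offDiag, 1 - coord),
    ofEntries_mem (by simp [mem_diagAtEnds, offDiag])⟩

/-- Scalar functions as elements of `twoProjAlgebra`. -/
noncomputable def scalarHom : C(unitInterval, ℂ) →⋆ₐ[ℂ] twoProjAlgebra where
  toFun f := ⟨ofEntries (f, 0, 0, f), ofEntries_mem (by simp [mem_diagAtEnds])⟩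
  map_one' := by
    ext t i j
    fin_cases i <;> fin_cases j <;> simp [ofEntries]
  map_mul' f g := by
    ext t i j
    fin_cases i <;> fin_cases j <;> simp [ofEntries]
  map_zero' := by
    ext t i j
    fin_cases i <;> fin_cases j <;> simp [ofEntries]
  map_add' f g := by
    ext t i j
    fin_cases i <;> fin_cases j <;> simp [ofEntries]
  commutes' c := by
    ext t i j
    fin_cases i <;> fin_cases j <;> simp [ofEntries]
  map_star' f := by
    ext t i j
    fin_cases i <;> fin_cases j <;> simp [ofEntries, Matrix.star_apply]

lemma coe_scalarHom (f : C(unitInterval, ℂ)) :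
    (scalarHom f : C(unitInterval, Matrix (Fin 2) (Fin 2) ℂ)) = ofEntries (f, 0, 0, f) := rfl

lemma star_projP : star projP = projP := by
  ext t i j
  fin_cases i <;> fin_cases j <;> simp [ofEntries, projP, Matrix.star_apply]

lemma projP_mul_self : projP * projP = projP := by
  ext t i j
  fin_cases i <;> fin_cases j <;> simp [ofEntries, projP]

lemma star_projQ : star projQ = projQ := by
  ext t i j
  fin_cases i <;> fin_cases j <;> simp [ofEntries, projQ, Matrix.star_apply, coord, offDiag]

lemma projQ_mul_self : projQ * projQ = projQ := by
  ext t i j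
  have h := congrArg (fun f => f t) offDiag_mul_self
  simp only [ContinuousMap.mul_apply, ContinuousMap.sub_apply, ContinuousMap.one_apply] at h
  fin_cases i <;> fin_cases j <;> simp [ofEntries, projQ, h] <;> ring

lemma projP_add_projPCompl : projP + projPCompl = 1 := by
  ext t i j
  fin_cases i <;> fin_cases j <;> simp [ofEntries, projP, projPCompl]

lemma scalarHom_coord :
    scalarHom coord + (projP + projQ) = 1 + (projP * projQ + projQ * projP) := by
  ext t i j
  fin_cases i <;> fin_cases j <;> simp [coe_scalarHom, ofEntries, projP, projQ] <;> ring

/-- The element of `twoProjAlgebra` with given entries. -/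
noncomputable def fromEntries : diagAtEnds →ₗ[ℂ] twoProjAlgebra where
  toFun v := ⟨ofEntries v, ofEntries_mem v.2⟩
  map_add' v w := by
    ext t i j
    fin_cases i <;> fin_cases j <;> simp [ofEntries]
  map_smul' c v := by
    ext t i j
    fin_cases i <;> fin_cases j <;> simp [ofEntries]

lemma coe_fromEntries (v : diagAtEnds) :
    (fromEntries v : C(unitInterval, Matrix (Fin 2) (Fin 2) ℂ)) = ofEntries v := rfl

lemma fromEntries_scale (v : Entries) :
    fromEntries (scale v) = scalarHom v.1 * projP
      + scalarHom v.2.1 * (projP * projQ * projPCompl)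
      + scalarHom v.2.2.1 * (projPCompl * projQ * projP)
      + scalarHom v.2.2.2 * projPCompl := by
  ext t i j
  fin_cases i <;> fin_cases j <;>
    simp [coe_fromEntries, coe_scale, coe_scalarHom, ofEntries, projP, projPCompl, projQ, mul_comm]

/-- The diagonal matrix units. -/
noncomputable def diagUnit : Fin 2 → twoProjAlgebra := ![projP, projPCompl]

lemma diagUnit_apply (i : Fin 2) (t : unitInterval) :
    (diagUnit i : C(unitInterval, Matrix (Fin 2) (Fin 2) ℂ)) t = Matrix.single i i 1 := by
  ext k l
  fin_cases i <;> fin_cases k <;> fin_cases l <;>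
    simp [diagUnit, projP, projPCompl, ofEntries]

lemma scalarHom_apply (f : C(unitInterval, ℂ)) (t : unitInterval) :
    (scalarHom f : C(unitInterval, Matrix (Fin 2) (Fin 2) ℂ)) t = Matrix.scalar (Fin 2) (f t) := by
  ext k l
  fin_cases k <;> fin_cases l <;> simp [coe_scalarHom, ofEntries]

lemma compression_mul_star (i j : Fin 2) (f : twoProjAlgebra) :
    diagUnit i * f * diagUnit j * star (diagUnit i * f * diagUnit j) =
      scalarHom (entry i j f * star (entry i j f)) * diagUnit i := by
  refine Subtype.ext (ContinuousMap.ext fun t => ?_)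
  change (diagUnit i).1 t * f.1 t * (diagUnit j).1 t *
      star ((diagUnit i).1 t * f.1 t * (diagUnit j).1 t) =
    (scalarHom (entry i j f * star (entry i j f))).1 t * (diagUnit i).1 t
  rw [diagUnit_apply, diagUnit_apply, scalarHom_apply, Matrix.single_mul_mul_single,
    Matrix.star_eq_conjTranspose, Matrix.conjTranspose_single, Matrix.single_mul_single_same]
  ext k l
  simp [entry, Matrix.single_apply, Matrix.diagonal_mul]

lemma sum_compression (f : twoProjAlgebra) : ∑ i, ∑ j, diagUnit i * f * diagUnit j = f := by
  have h : ∑ i, diagUnit i = 1 := by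
    rw [Fin.sum_univ_two]
    exact projP_add_projPCompl
  simp only [← Finset.mul_sum, ← Finset.sum_mul, h, one_mul, mul_one]

lemma norm_starAlgHom_le (φ : twoProjAlgebra →⋆ₐ[ℂ] B) (f : twoProjAlgebra) :
    ‖φ f‖ ≤ ∑ i, ∑ j, (‖φ (diagUnit i)‖ + 1) * ‖entry i j f‖ := by
  conv_lhs => rw [← sum_compression f, map_sum]
  refine norm_sum_le_of_le _ fun i _ => ?_
  rw [map_sum]
  refine norm_sum_le_of_le _ fun j _ => norm_le_of_mul_star_eq (φ.comp scalarHom) ?_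
  rw [← map_star, ← map_mul, compression_mul_star, map_mul]
  rfl

lemma entry_ofEntries (v : Entries) (i j : Fin 2) :
    entry i j (ofEntries v) = !![v.1, v.2.1; v.2.2.1, v.2.2.2] i j := by
  ext t
  fin_cases i <;> fin_cases j <;> simp [entry, ofEntries]

lemma norm_entry_fromEntries_le (v : diagAtEnds) (i j : Fin 2) :
    ‖entry i j (fromEntries v)‖ ≤ ‖v‖ := by
  have n₂ : ‖(v : Entries).2‖ ≤ ‖v‖ := norm_snd_le (v : Entries)
  have n₃ : ‖(v : Entries).2.2‖ ≤ ‖v‖ := (norm_snd_le (v : Entries).2).trans n₂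
  rw [coe_fromEntries, entry_ofEntries]
  fin_cases i <;> fin_cases j
  · exact norm_fst_le (v : Entries)
  · exact (norm_fst_le (v : Entries).2).trans n₂
  · exact (norm_fst_le (v : Entries).2.2).trans n₃
  · exact (norm_snd_le (v : Entries).2.2).trans n₃

lemma continuous_starAlgHom_fromEntries (φ : twoProjAlgebra →⋆ₐ[ℂ] B) :
    Continuous fun v => φ (fromEntries v) := by
  refine AddMonoidHomClass.continuous_of_bound
    ((φ : twoProjAlgebra →+ B).comp fromEntries.toAddMonoidHom)
    (∑ i, ∑ _j : Fin 2, (‖φ (diagUnit i)‖ + 1)) fun v => ?_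
  refine (norm_starAlgHom_le φ (fromEntries v)).trans ?_
  simp only [Finset.sum_mul]
  gcongr with i _ j _
  exact norm_entry_fromEntries_le v i j

lemma starAlgHom_ext {φ ψ : twoProjAlgebra →⋆ₐ[ℂ] B} (hP : φ projP = ψ projP)
    (hQ : φ projQ = ψ projQ) : φ = ψ := by
  have hs : φ.comp scalarHom = ψ.comp scalarHom :=
    hom_ext <| add_right_cancel (b := ψ projP + ψ projQ) <| by
      have h := congrArg φ scalarHom_coord
      have h' := congrArg ψ scalarHom_coord
      simp only [map_add, map_mul, map_one, hP, hQ] at h h'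
      exact h.trans h'.symm
  have hP' : φ projPCompl = ψ projPCompl := add_left_cancel (a := ψ projP) <| by
    rw [← map_add, ← hP, ← map_add, projP_add_projPCompl, map_one, map_one]
  have hs' : ∀ f, φ (scalarHom f) = ψ (scalarHom f) := fun f => DFunLike.congr_fun hs f
  have h : (fun v => φ (fromEntries v)) = fun v => ψ (fromEntries v) := by
    refine denseRange_scale.equalizer (continuous_starAlgHom_fromEntries φ)
      (continuous_starAlgHom_fromEntries ψ) (funext fun v => ?_)
    simp [fromEntries_scale, hs', hP, hP', hQ]
  ext f
  have hf : fromEntries ⟨entries f, entries_mem f.2⟩ = f :=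
    Subtype.ext (ofEntries_entries f)
  rw [← hf]
  exact congrFun h _

lemma exists_starAlgHom_of_projections {p q : B} (hp : star p = p) (hpp : p * p = p)
    (hq : star q = q) (hqq : q * q = q) :
    ∃ φ : twoProjAlgebra →⋆ₐ[ℂ] B, φ projP = p ∧ φ projQ = q := by
  obtain ⟨H, hH⟩ := exists_hom hp hpp hq hqq
  have hp' : ∀ z, p * (p * z) = p * z := fun z => by rw [← mul_assoc, hpp]
  have hq' : ∀ z, q * (q * z) = q * z := fun z => by rw [← mul_assoc, hqq]
  have hHp : ∀ f, Commute (H f) p := commute_hom H hp <| by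
    rw [hH, commute_iff_eq]
    simp only [mul_sub, sub_mul, mul_assoc, hpp, hqq, hp', one_mul, mul_one]
    abel
  have hHq : ∀ f, Commute (H f) q := commute_hom H hq <| by
    rw [hH, commute_iff_eq]
    simp only [mul_sub, sub_mul, mul_assoc, hpp, hqq, hq', one_mul, mul_one]
    abel
  have hHy : ∀ f, Commute (H f) (p * q * (1 - p)) := fun f =>
    ((hHp f).mul_right (hHq f)).mul_right ((Commute.one_right _).sub_right (hHp f))
  have hsy : star (p * q * (1 - p)) = (1 - p) * q * p := by
    simp [hp, hq, mul_assoc]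
  obtain ⟨φ, hφ⟩ := exists_starAlgHom (H := H) (y := p * q * (1 - p)) hpp hp
    (by simp only [← mul_assoc, hpp])
    (by rw [mul_assoc, sub_mul, one_mul, hpp, sub_self, mul_zero])
    (by
      rw [hsy, offDiag_mul_self, map_mul, map_sub, map_one, hH]
      simp only [mul_sub, sub_mul, mul_assoc, hpp, hqq, hp', hq', one_mul, mul_one]
      abel)
    (by
      rw [hsy, offDiag_mul_self, map_mul, map_sub, map_one, hH]
      simp only [mul_sub, sub_mul, mul_assoc, hpp, hqq, hp', hq', one_mul, mul_one]
      abel) hHp hHy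
  refine ⟨φ, ?_, ?_⟩
  · rw [hφ projP (1, 0, 0, 0)]
    · simp [scaledHom_apply]
    · simp only [coe_scale, projP, entries, entry_ofEntries]
      simp
  · rw [hφ projQ (coord, 1, 1, 1 - coord)]
    · rw [scaledHom_apply, hsy]
      simp only [map_sub, map_one, hH]
      simp only [mul_sub, sub_mul, mul_assoc, hpp, hqq, one_mul, mul_one]
      abel
    · simp only [coe_scale, projQ, entries, entry_ofEntries]
      simp

end CStar

end TwoProj

/-- `D = {f ∈ C([0,1], M₂(ℂ)) : f(0), f(1) diagonal}` together with the projections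
`P(t) = [[1,0],[0,0]]` and `Q(t) = [[t, √(t(1-t))],[√(t(1-t)), 1-t]]` is the universal
unital C*-algebra generated by two projections, i.e. `ℂ² *_ℂ ℂ²`:  for every unital
C*-algebra `B` and every pair of projections `p, q ∈ B` there is a unique unital
star-algebra homomorphism `φ : D → B` with `φ(P) = p` and `φ(Q) = q`. -/
theorem universal_two_projections :
    ∃ (P Q : C(unitInterval, Matrix (Fin 2) (Fin 2) ℂ))
      (hP : P ∈ twoProjAlgebra) (hQ : Q ∈ twoProjAlgebra),
      (∀ t : unitInterval, P t = !![1, 0; 0, 0]) ∧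
      (∀ t : unitInterval, Q t =
        !![((t : ℝ) : ℂ), ((Real.sqrt ((t : ℝ) * (1 - (t : ℝ)))) : ℂ);
           ((Real.sqrt ((t : ℝ) * (1 - (t : ℝ)))) : ℂ), ((1 - (t : ℝ) : ℝ) : ℂ)]) ∧
      star P = P ∧ P * P = P ∧ star Q = Q ∧ Q * Q = Q ∧
      ∀ (B : Type) [NormedRing B] [StarRing B] [CStarRing B] [NormedAlgebra ℂ B]
        [StarModule ℂ B] [CompleteSpace B] (p q : B),
        star p = p → p * p = p → star q = q → q * q = q →
        ∃! φ : twoProjAlgebra →⋆ₐ[ℂ] B, φ 1 = 1 ∧ φ ⟨P, hP⟩ = p ∧ φ ⟨Q, hQ⟩ = q := by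
  refine ⟨TwoProj.projP, TwoProj.projQ, TwoProj.projP.2, TwoProj.projQ.2, ?_, ?_,
    congrArg Subtype.val TwoProj.star_projP, congrArg Subtype.val TwoProj.projP_mul_self,
    congrArg Subtype.val TwoProj.star_projQ, congrArg Subtype.val TwoProj.projQ_mul_self, ?_⟩
  · intro t
    simp [TwoProj.projP, TwoProj.ofEntries]
  · intro t
    simp [TwoProj.projQ, TwoProj.ofEntries, TwoProj.coord, TwoProj.offDiag]
  · intro B _ _ _ _ _ _ p q hp hpp hq hqq
    let _ : CStarAlgebra B := {}
    obtain ⟨φ, hP, hQ⟩ := TwoProj.exists_starAlgHom_of_projections hp hpp hq hqq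
    exact ⟨φ, ⟨map_one φ, hP, hQ⟩, fun ψ h =>
      TwoProj.starAlgHom_ext (h.2.1.trans hP.symm) (h.2.2.trans hQ.symm)⟩
end

section
/- Let A be a unital C*-algebra and let p, q ∈ A be projections with ‖pq − qp‖ < 1/2. Then there exists a projection q′ ∈ A such that p q′ = q′ p and ‖q − q′‖ ≤ 2‖pq − qp‖; moreover if pq = qp one can take q′ = q. (This is the key step showing that the quotient map from the soft tensor product ℂ² ⊛_ε ℂ² onto ℂ² ⊗ ℂ² splits as soon as ε < 1/2.) -/
/-- In a C*-algebra, a self-adjoint `x` with `‖x - x * x‖ ≤ r < 1 / 4` is within `2 * r` of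
a projection that commutes with everything commuting with `x`. -/
theorem exists_projection_near_of_norm_sub_mul_self_le {A : Type*} [CStarAlgebra A]
    {x : A} (hx : IsSelfAdjoint x) {r : ℝ} (hxr : ‖x - x * x‖ ≤ r) (hr : r < 1 / 4) :
    ∃ y : A, star y = y ∧ y * y = y ∧ (∀ z, Commute x z → Commute y z) ∧
      ‖x - y‖ ≤ 2 * r := by
  have hr0 : 0 ≤ r := (norm_nonneg _).trans hxr
  have hspec : ∀ t ∈ spectrum ℝ x, |t - t * t| ≤ r := by
    intro t ht
    have hcfc : cfc (fun t : ℝ ↦ t - t * t) x = x - x * x := by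
      rw [cfc_sub (fun t : ℝ ↦ t) (fun t ↦ t * t) x, cfc_mul (fun t : ℝ ↦ t) (fun t ↦ t) x,
        cfc_id' ℝ x]
    have hle := norm_apply_le_norm_cfc (fun t : ℝ ↦ t - t * t) x ht
    rw [hcfc, Real.norm_eq_abs] at hle
    exact hle.trans hxr
  let f : ℝ → ℝ := fun t ↦ if t < 1 / 2 then 0 else 1
  have hf : ContinuousOn f (spectrum ℝ x) := by
    refine ContinuousOn.if ?_ continuousOn_const continuousOn_const
    rintro t ⟨ht, hfr⟩
    have hfr' : t ∈ frontier (Set.Iio (1 / 2 : ℝ)) := hfr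
    rw [frontier_Iio, Set.mem_singleton_iff] at hfr'
    have hle := hspec t ht
    rw [hfr'] at hle
    norm_num at hle
    linarith
  refine ⟨cfc f x, IsSelfAdjoint.cfc, ?_, fun z hz ↦ hx.commute_cfc hz f, ?_⟩
  · rw [← cfc_mul f f x]
    congr 1
    funext t
    simp [f]
  · have hsub : x - cfc f x = cfc (fun t ↦ t - f t) x := by
      rw [cfc_sub (fun t : ℝ ↦ t) f x, cfc_id' ℝ x]
    rw [hsub]
    refine norm_cfc_le (by positivity) fun t ht ↦ ?_
    have hle := hspec t ht
    rw [abs_le] at hle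
    rw [Real.norm_eq_abs, abs_le]
    by_cases h2 : t < 1 / 2
    · simp only [f, h2, if_true]
      constructor <;> nlinarith
    · simp only [f, h2, if_false]
      constructor <;> nlinarith

/-- If `p, q` are projections in a unital C*-algebra with `‖pq − qp‖ < 1/2`, then there is
a projection `q′` commuting with `p` with `‖q − q′‖ ≤ 2‖pq − qp‖`; moreover if `pq = qp`
one can take `q′ = q`. -/
theorem almost_commuting_projection (A : Type) [NormedRing A] [StarRing A] [CStarRing A]
    [NormedAlgebra ℂ A] [StarModule ℂ A] [CompleteSpace A]
    (p q : A) (hp₁ : star p = p) (hp₂ : p * p = p) (hq₁ : star q = q) (hq₂ : q * q = q)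
    (h : ‖p * q - q * p‖ < 1 / 2) :
    ∃ q' : A, star q' = q' ∧ q' * q' = q' ∧ p * q' = q' * p ∧
      ‖q - q'‖ ≤ 2 * ‖p * q - q * p‖ ∧ (p * q = q * p → q' = q) := by
  let _ : CStarAlgebra A := {}
  set x : A := p * q * p + (1 - p) * q * (1 - p) with hx
  have hp' (a : A) : p * (p * a) = p * a := by rw [← mul_assoc, hp₂]
  have hq' (a : A) : q * (q * a) = q * a := by rw [← mul_assoc, hq₂]
  have hu : p + p - 1 ∈ unitary A := by
    rw [Unitary.mem_iff]
    simp only [star_sub, star_add, star_one, hp₁]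
    constructor <;> noncomm_ring <;> simp only [hp₂] <;> abel
  have he : q - x = (p + p - 1) * (p * q - q * p) := by
    rw [hx]
    noncomm_ring
    simp only [hp']
    abel
  have hnorm : ‖q - x‖ = ‖p * q - q * p‖ := by
    rw [he, CStarRing.norm_mem_unitary_mul _ hu]
  have hxx : x - x * x = (q - x) * (q - x) := by
    rw [hx]
    noncomm_ring
    simp only [hp', hq', hq₂]
    abel
  have hxsa : IsSelfAdjoint x := by
    rw [IsSelfAdjoint, hx]
    simp only [star_add, star_mul, star_sub, star_one, hp₁, hq₁, mul_assoc]
  have hpx : Commute x p := by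
    rw [Commute, SemiconjBy, hx]
    noncomm_ring
    simp only [hp', hp₂]
    abel
  have hxr : ‖x - x * x‖ ≤ ‖p * q - q * p‖ * ‖p * q - q * p‖ := by
    rw [hxx, ← hnorm]
    exact norm_mul_le _ _
  have hδ := norm_nonneg (p * q - q * p)
  obtain ⟨y, hy₁, hy₂, hyc, hxy⟩ :=
    exists_projection_near_of_norm_sub_mul_self_le hxsa hxr (by nlinarith)
  have hqy : ‖q - y‖ ≤ 2 * ‖p * q - q * p‖ := by
    have htri := norm_sub_le_norm_sub_add_norm_sub q x y
    nlinarith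
  refine ⟨y, hy₁, hy₂, (hyc p hpx).symm.eq, hqy, fun hpq ↦ ?_⟩
  rw [hpq, sub_self, norm_zero, mul_zero] at hqy
  exact (sub_eq_zero.mp (norm_le_zero_iff.mp hqy)).symm
end

section
/- Let G and H be abelian groups, and let r ∈ G and s ∈ H be elements of finite order whose orders are relatively prime. Then the quotient group (G × H)/⟨(r, −s)⟩ is isomorphic, as an abelian group, to (G/⟨r⟩) × (H/⟨s⟩). (This computes K₀(A *_ℂ B) in the case where K₀(A) = G with [1_A] = r and K₀(B) = H with [1_B] = s are torsion.) -/
/-- An element of a product whose components have coprime orders generates the product of the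
cyclic subgroups generated by its components. -/
theorem AddSubgroup.zmultiples_prodMk_of_coprime {G H : Type*} [AddCommGroup G] [AddCommGroup H]
    {a : G} {b : H} (hco : Nat.Coprime (addOrderOf a) (addOrderOf b)) :
    AddSubgroup.zmultiples ((a, b) : G × H)
      = (AddSubgroup.zmultiples a).prod (AddSubgroup.zmultiples b) := by
  obtain ⟨u, v, huv⟩ := Nat.isCoprime_iff_coprime.2 hco
  have ha : (addOrderOf a : ℤ) • a = 0 := by rw [natCast_zsmul, addOrderOf_nsmul_eq_zero]
  have hb : (addOrderOf b : ℤ) • b = 0 := by rw [natCast_zsmul, addOrderOf_nsmul_eq_zero]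
  ext ⟨x, y⟩
  simp only [AddSubgroup.mem_prod, AddSubgroup.mem_zmultiples_iff, Prod.smul_mk, Prod.mk.injEq]
  constructor
  · rintro ⟨k, hx, hy⟩
    exact ⟨⟨k, hx⟩, ⟨k, hy⟩⟩
  · rintro ⟨⟨i, rfl⟩, ⟨j, rfl⟩⟩
    refine ⟨i + (j - i) * u * addOrderOf a, ?_, ?_⟩
    · rw [add_zsmul, mul_zsmul, ha, zsmul_zero, add_zero]
    · have h : i + (j - i) * u * addOrderOf a = j + (i - j) * v * addOrderOf b := by
        linear_combination (j - i) * huv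
      rw [h, add_zsmul, mul_zsmul, hb, zsmul_zero, add_zero]

/-- If `r ∈ G` and `s ∈ H` have finite, relatively prime orders, then
`(G × H)/⟨(r, −s)⟩ ≅ (G/⟨r⟩) × (H/⟨s⟩)`. -/
theorem quotient_by_diagonal_torsion_iso (G H : Type) [AddCommGroup G] [AddCommGroup H]
    (r : G) (s : H) (hr : IsOfFinAddOrder r) (hs : IsOfFinAddOrder s)
    (hco : Nat.Coprime (addOrderOf r) (addOrderOf s)) :
    Nonempty (((G × H) ⧸ AddSubgroup.zmultiples ((r, -s) : G × H))
      ≃+ (G ⧸ AddSubgroup.zmultiples r) × (H ⧸ AddSubgroup.zmultiples s)) := by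
  let f := (QuotientAddGroup.mk' (AddSubgroup.zmultiples r)).prodMap
    (QuotientAddGroup.mk' (AddSubgroup.zmultiples s))
  have hf : Function.Surjective f :=
    (QuotientAddGroup.mk'_surjective _).prodMap (QuotientAddGroup.mk'_surjective _)
  have hker : AddSubgroup.zmultiples ((r, -s) : G × H) = f.ker := by
    rw [AddSubgroup.zmultiples_prodMk_of_coprime (by rwa [addOrderOf_neg]),
      AddSubgroup.zmultiples_neg, AddMonoidHom.ker_prodMap, QuotientAddGroup.ker_mk',
      QuotientAddGroup.ker_mk']
  exact ⟨(QuotientAddGroup.quotientAddEquivOfEq hker).trans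
    (QuotientAddGroup.quotientKerEquivOfSurjective f hf)⟩
end
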